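/- Let A, E be elements of F_o and suppose that E is a traffic envelope for A, i.e., A(t+s) ≤ A(t) + E(s) for all t, s ≥ 0. Then E^↑ is a max-plus traffic envelope for A^↑, i.e., A^↑(ν) + E^↑(μ) ≤ A^↑(ν+μ) for all ν, μ ≥ 0. -/

import Mathlib

open Set

/-- Upper pseudo-inverse: `F^↑(y) = sup {x | F x ≤ y}` (as an extended real,
with `sSup ∅ = ⊥`). -/
noncomputable def upInv (F : ℝ → EReal) (y : ℝ) : EReal :=
  sSup (Real.toEReal '' {x : ℝ | F x ≤ (y : EReal)})

/-- Lower pseudo-inverse: `F^↓(y) = inf {x | F x ≥ y}` (as an extended real,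
with `sInf ∅ = ⊤`). -/
noncomputable def loInv (F : ℝ → EReal) (y : ℝ) : EReal :=
  sInf (Real.toEReal '' {x : ℝ | (y : EReal) ≤ F x})

/-- `F ∈ F_o`: non-decreasing, left-continuous, valued in `[0,∞]`, and `F t = 0` for `t ≤ 0`. -/
def MemFo (F : ℝ → EReal) : Prop :=
  Monotone F ∧ (∀ x : ℝ, ContinuousWithinAt F (Iic x) x) ∧
    (∀ x : ℝ, 0 ≤ F x) ∧ (∀ x : ℝ, x ≤ 0 → F x = 0)

/-- `F ∈ T_o`: non-decreasing, right-continuous, `F ν = −∞` for `ν < 0`,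
`F ν ≥ 0` for `ν ≥ 0`. -/
def MemTo (F : ℝ → EReal) : Prop :=
  Monotone F ∧ (∀ x : ℝ, ContinuousWithinAt F (Ici x) x) ∧
    (∀ x : ℝ, x < 0 → F x = ⊥) ∧ (∀ x : ℝ, 0 ≤ x → 0 ≤ F x)

/-- Min-plus convolution `F ⊗ G (t) = inf_{0 ≤ s ≤ t} (F s + G (t−s))`. -/
noncomputable def minConv (F G : ℝ → EReal) (t : ℝ) : EReal :=
  sInf ((fun s => F s + G (t - s)) '' Icc 0 t)

/-- Max-plus convolution `F ⊗̄ G (ν) = sup_{0 ≤ κ ≤ ν} (F κ + G (ν−κ))`. -/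
noncomputable def maxConv (F G : ℝ → EReal) (ν : ℝ) : EReal :=
  sSup ((fun κ => F κ + G (ν - κ)) '' Icc 0 ν)

/-- Below the upper pseudo-inverse of `F ∈ F_o` at a nonnegative level, there is always a
nonnegative point of the corresponding sublevel set. -/
theorem exists_nonneg_of_lt_upInv {F : ℝ → EReal} (hF : MemFo F) {y : ℝ} (hy : 0 ≤ y)
    {a : EReal} (ha : a < upInv F y) :
    ∃ x : ℝ, a < x ∧ 0 ≤ x ∧ F x ≤ (y : EReal) := by
  obtain ⟨_, ⟨x, hx, rfl⟩, hax⟩ := lt_sSup_iff.1 ha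
  rcases le_total 0 x with h | h
  · exact ⟨x, hax, h, hx⟩
  · refine ⟨0, hax.trans_le (EReal.coe_le_coe_iff.2 h), le_rfl, ?_⟩
    rw [hF.2.2.2 0 le_rfl]
    exact EReal.coe_nonneg.2 hy

/-- If `A, E ∈ F_o` and `E` is a traffic envelope for `A`
(`A(t+s) ≤ A(t) + E(s)` for `t, s ≥ 0`), then `E^↑` is a max-plus traffic
envelope for `A^↑`: `A^↑(ν) + E^↑(μ) ≤ A^↑(ν+μ)` for `ν, μ ≥ 0`. -/
theorem envelope_to_maxplus (A E : ℝ → EReal) (hA : MemFo A) (hE : MemFo E)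
    (henv : ∀ t : ℝ, 0 ≤ t → ∀ s : ℝ, 0 ≤ s → A (t + s) ≤ A t + E s) :
    ∀ ν : ℝ, 0 ≤ ν → ∀ μ : ℝ, 0 ≤ μ → upInv A ν + upInv E μ ≤ upInv A (ν + μ) := by
  intro ν hν μ hμ
  refine EReal.add_le_of_forall_lt fun a ha b hb => ?_
  obtain ⟨x, hax, hx0, hx⟩ := exists_nonneg_of_lt_upInv hA hν ha
  obtain ⟨y, hby, hy0, hy⟩ := exists_nonneg_of_lt_upInv hE hμ hb
  have hxy : A (x + y) ≤ ((ν + μ : ℝ) : EReal) := by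
    rw [EReal.coe_add]
    exact (henv x hx0 y hy0).trans (add_le_add hx hy)
  calc a + b ≤ (x : EReal) + y := add_le_add hax.le hby.le
    _ = ((x + y : ℝ) : EReal) := (EReal.coe_add x y).symm
    _ ≤ upInv A (ν + μ) := le_sSup (mem_image_of_mem _ hxy)
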